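/- Let 0 ≤ m ≤ n−1 be such that gcd(m, n) = 2^w for some integer w ≥ 0 (i.e., m ∈ φ₂(n)). Then there exists an integer N ≥ 0 such that c_m^N lies in the two-sided ideal (e₀) of A#C_n. -/

import Mathlib

open scoped BigOperators

namespace NCIS

variable (k : Type*) [Field k] (n : ℕ)

/-- Relations defining the skew group algebra `A # C_n`, where
`A = k_{-1}[x_0, …, x_{n-1}]`: the generators are `x_i` (`Sum.inl i`) and `s` (`Sum.inr ()`),
subject to `x_i x_j + x_j x_i = 0` for `i ≠ j`, `s^n = 1` and `s x_i = x_{i+1} s`. -/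
inductive SGRel : FreeAlgebra k (ZMod n ⊕ Unit) → FreeAlgebra k (ZMod n ⊕ Unit) → Prop
  | anti (i j : ZMod n) (h : i ≠ j) :
      SGRel (FreeAlgebra.ι k (Sum.inl i) * FreeAlgebra.ι k (Sum.inl j)
           + FreeAlgebra.ι k (Sum.inl j) * FreeAlgebra.ι k (Sum.inl i)) 0
  | spow : SGRel (FreeAlgebra.ι k (Sum.inr ()) ^ n) 1
  | scomm (i : ZMod n) :
      SGRel (FreeAlgebra.ι k (Sum.inr ()) * FreeAlgebra.ι k (Sum.inl i))
            (FreeAlgebra.ι k (Sum.inl (i + 1)) * FreeAlgebra.ι k (Sum.inr ()))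

/-- The skew group algebra `A # C_n`. -/
abbrev SkewGroup := RingQuot (SGRel k n)

/-- The image of the generator `x_i` in `A # C_n`. -/
noncomputable def xg (i : ZMod n) : SkewGroup k n :=
  RingQuot.mkAlgHom k (SGRel k n) (FreeAlgebra.ι k (Sum.inl i))

/-- The image of the generator `s` in `A # C_n`. -/
noncomputable def sg : SkewGroup k n :=
  RingQuot.mkAlgHom k (SGRel k n) (FreeAlgebra.ι k (Sum.inr ()))

/-- The integral `e₀ = (1/n) ∑_{i=0}^{n-1} s^i` in `A # C_n`. -/
noncomputable def e0 : SkewGroup k n := (n : k)⁻¹ • ∑ i ∈ Finset.range n, sg k n ^ i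

/-- The quotient algebra `E = (A # C_n)/(e₀)` of `A # C_n` by the two-sided ideal
generated by `e₀`. -/
abbrev Equot := RingQuot (fun a b : SkewGroup k n => a = e0 k n ∧ b = 0)

end NCIS

namespace NCIS

variable (k : Type*) [Field k] (n : ℕ)

/-- The eigenvector `b_γ = (1/n) ∑_{i=0}^{n-1} ω^{iγ} x_i` in `A ⊆ A # C_n`. -/
noncomputable def bg (ω : k) (γ : ZMod n) : SkewGroup k n :=
  (n : k)⁻¹ • ∑ i ∈ Finset.range n, ω ^ (i * γ.val) • xg k n (i : ZMod n)

/-- The central element `c_j = (2/n²) ∑_{i=0}^{n-1} ω^{ij} x_i²` of `A ⊆ A # C_n`. -/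
noncomputable def cg (ω : k) (j : ZMod n) : SkewGroup k n :=
  (2 / (n : k) ^ 2) • ∑ i ∈ Finset.range n, ω ^ (i * j.val) • xg k n (i : ZMod n) ^ 2

/-- The idempotent `e_α = (1/n) ∑_{i=0}^{n-1} (ω^α s)^i` in `A # C_n`. -/
noncomputable def eg (ω : k) (α : ZMod n) : SkewGroup k n :=
  (n : k)⁻¹ • ∑ i ∈ Finset.range n, (ω ^ α.val • sg k n) ^ i

end NCIS

namespace NCIS

section Characters

variable (k : Type*) [Field k] (n : ℕ)

/-- The unnormalized idempotent `∑ zⁱ sⁱ` of the group algebra. -/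
noncomputable def charE (z : k) : SkewGroup k n :=
  ∑ i ∈ Finset.range n, z ^ i • sg k n ^ i

/-- The unnormalized eigenvector `∑ zⁱ xᵢ`. -/
noncomputable def charB (z : k) : SkewGroup k n :=
  ∑ i ∈ Finset.range n, z ^ i • xg k n (i : ZMod n)

/-- The unnormalized sum of squares `∑ zⁱ xᵢ²`. -/
noncomputable def charC (z : k) : SkewGroup k n :=
  ∑ i ∈ Finset.range n, z ^ i • xg k n (i : ZMod n) ^ 2

lemma xg_anticomm {i j : ZMod n} (h : i ≠ j) :
    xg k n i * xg k n j + xg k n j * xg k n i = 0 := by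
  simpa [xg] using RingQuot.mkAlgHom_rel k (SGRel.anti (k := k) i j h)

lemma sg_mul_xg (i : ZMod n) : sg k n * xg k n i = xg k n (i + 1) * sg k n := by
  simpa [xg, sg] using RingQuot.mkAlgHom_rel k (SGRel.scomm (k := k) i)

lemma sg_mul_xg_sq (i : ZMod n) :
    sg k n * xg k n i ^ 2 = xg k n (i + 1) ^ 2 * sg k n := by
  rw [pow_two, ← mul_assoc, sg_mul_xg, mul_assoc, sg_mul_xg, ← mul_assoc, ← pow_two]

lemma commute_sq_of_anticomm {R : Type*} [Ring R] {a b : R} (h : a * b + b * a = 0) :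
    Commute (a ^ 2) b := by
  have h1 : a * b = -(b * a) := eq_neg_of_add_eq_zero_left h
  change a ^ 2 * b = b * a ^ 2
  rw [pow_two, mul_assoc, h1, mul_neg, ← mul_assoc, h1, neg_mul, neg_neg, mul_assoc]

lemma commute_xg_sq (i j : ZMod n) : Commute (xg k n i ^ 2) (xg k n j) := by
  by_cases h : i = j
  · subst h
    exact (Commute.refl _).pow_left 2
  · exact commute_sq_of_anticomm (xg_anticomm k n h)

lemma commute_charC_charB (y z : k) : Commute (charC k n y) (charB k n z) :=
  Commute.sum_left _ _ _ fun i _ => Commute.sum_right _ _ _ fun j _ =>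
    ((commute_xg_sq k n i j).smul_left _).smul_right _

lemma charB_mul_add_mul (y z : k) :
    charB k n y * charB k n z + charB k n z * charB k n y = (2 : k) • charC k n (y * z) := by
  have h (u v : k) : charB k n u * charB k n v = ∑ i ∈ Finset.range n, ∑ j ∈ Finset.range n,
      (u ^ i * v ^ j) • (xg k n (i : ZMod n) * xg k n (j : ZMod n)) := by
    simp only [charB, Finset.sum_mul_sum, smul_mul_smul_comm]
  rw [h y z, h z y, Finset.sum_comm (f := fun i j => (z ^ i * y ^ j) • _),
    ← Finset.sum_add_distrib, charC, Finset.smul_sum]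
  refine Finset.sum_congr rfl fun i hi => ?_
  rw [← Finset.sum_add_distrib, Finset.sum_eq_single i]
  · rw [mul_comm (z ^ i), ← mul_pow, ← pow_two, ← two_smul k]
  · intro j hj hji
    rw [mul_comm (z ^ j), ← smul_add, xg_anticomm, smul_zero]
    intro hij
    rw [ZMod.natCast_eq_natCast_iff', Nat.mod_eq_of_lt (Finset.mem_range.1 hi),
      Nat.mod_eq_of_lt (Finset.mem_range.1 hj)] at hij
    exact hji hij.symm
  · exact fun h => absurd hi h

variable {n}

/-- A sum `∑ zⁱ fᵢ` over a family permuted cyclically by `s` is an eigenvector of `s`. -/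
lemma sum_mul_sg (f : ZMod n → SkewGroup k n)
    (hf : ∀ i, sg k n * f i = f (i + 1) * sg k n) {z : k} (hz : z ^ n = 1) :
    (∑ i ∈ Finset.range n, z ^ i • f (i : ZMod n)) * sg k n =
      z • (sg k n * ∑ i ∈ Finset.range n, z ^ i • f (i : ZMod n)) := by
  have shift : ∑ i ∈ Finset.range n, z ^ (i + 1) • f ((i : ZMod n) + 1) =
      ∑ i ∈ Finset.range n, z ^ i • f (i : ZMod n) := by
    have h1 := Finset.sum_range_succ (fun i : ℕ => z ^ i • f (i : ZMod n)) n
    rw [Finset.sum_range_succ'] at h1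
    simpa [hz] using h1
  rw [← shift, Finset.sum_mul, shift, Finset.mul_sum, Finset.smul_sum]
  refine Finset.sum_congr rfl fun i _ => ?_
  rw [smul_mul_assoc, mul_smul_comm, hf, smul_smul, pow_succ']

lemma mul_charE_of_mul_sg {a : SkewGroup k n} {z : k}
    (h : a * sg k n = z • (sg k n * a)) (y : k) :
    a * charE k n y = charE k n (y * z) * a := by
  have hpow (i : ℕ) : a * sg k n ^ i = z ^ i • (sg k n ^ i * a) := by
    induction i with
    | zero => simp
    | succ i ih =>
      rw [pow_succ, ← mul_assoc, ih, smul_mul_assoc, mul_assoc, h, mul_smul_comm, smul_smul,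
        ← pow_succ, mul_assoc]
  simp only [charE, Finset.mul_sum, Finset.sum_mul]
  refine Finset.sum_congr rfl fun i _ => ?_
  rw [mul_smul_comm, hpow, smul_smul, smul_mul_assoc, mul_pow]

lemma charB_mul_charE {z : k} (hz : z ^ n = 1) (y : k) :
    charB k n z * charE k n y = charE k n (y * z) * charB k n z :=
  mul_charE_of_mul_sg k (sum_mul_sg k _ (sg_mul_xg k n) hz) y

lemma charC_mul_charE {z : k} (hz : z ^ n = 1) (y : k) :
    charC k n z * charE k n y = charE k n (y * z) * charC k n z :=
  mul_charE_of_mul_sg k (sum_mul_sg k (fun i => xg k n i ^ 2) (sg_mul_xg_sq k n) hz) y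

lemma sum_charE {ω : k} (hω : IsPrimitiveRoot ω n) :
    ∑ a ∈ Finset.range n, charE k n (ω ^ a) = (n : k) • 1 := by
  obtain rfl | hn := Nat.eq_zero_or_pos n
  · simp
  simp only [charE]
  rw [Finset.sum_comm, Finset.sum_eq_single 0]
  · simp [← Nat.cast_smul_eq_nsmul k]
  · intro i hi hi0
    have hne : ω ^ i ≠ 1 := hω.pow_ne_one_of_pos_of_lt hi0 (Finset.mem_range.1 hi)
    have hsum : ∑ a ∈ Finset.range n, (ω ^ a) ^ i = 0 := by
      simp only [fun a => pow_right_comm ω a i]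
      rw [geom_sum_eq hne, pow_right_comm, hω.pow_eq_one, one_pow, sub_self, zero_div]
    rw [← Finset.sum_smul, hsum, zero_smul]
  · intro h
    exact absurd (Finset.mem_range.2 hn) h

lemma smul_mem_twoSidedIdeal {R : Type*} [Ring R] [Algebra k R] (I : TwoSidedIdeal R) (t : k)
    {a : R} (ha : a ∈ I) : t • a ∈ I := by
  rw [Algebra.smul_def]
  exact I.mul_mem_left _ _ ha

variable (n) in
/-- Some power of `∑ μⁱ xᵢ²` sends the idempotent of the character `z` into `I`. -/
def Kills (I : TwoSidedIdeal (SkewGroup k n)) (μ z : k) : Prop :=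
  ∃ N : ℕ, charC k n μ ^ N * charE k n z ∈ I

variable {k} {I : TwoSidedIdeal (SkewGroup k n)} {μ z : k}

lemma Kills.of_mul (hμ : μ ^ n = 1) (h : Kills k n I μ (z * μ)) : Kills k n I μ z := by
  obtain ⟨N, hN⟩ := h
  refine ⟨N + 1, ?_⟩
  rw [pow_succ, mul_assoc, charC_mul_charE k hμ, ← mul_assoc]
  exact I.mul_mem_right _ _ hN

lemma Kills.of_mul_pow (hμ : μ ^ n = 1) (j : ℕ) (h : Kills k n I μ (z * μ ^ j)) :
    Kills k n I μ z := by
  induction j with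
  | zero => simpa using h
  | succ j ih =>
    rw [pow_succ, ← mul_assoc] at h
    exact ih (h.of_mul hμ)

lemma Kills.of_sq_mul [CharZero k] (hn : n ≠ 0) (hμ : μ ^ n = 1) (hz : z ^ n = 1)
    (h1 : charE k n 1 ∈ I) (h : Kills k n I μ (z ^ 2 * μ)) : Kills k n I μ z := by
  have hz0 : z ≠ 0 := by
    rintro rfl
    simp [hn] at hz
  obtain ⟨N, hN⟩ := h
  have hp : (z⁻¹) ^ n = 1 := by rw [inv_pow, hz, inv_one]
  have hq : (z * μ) ^ n = 1 := by rw [mul_pow, hz, hμ, one_mul]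
  have hC : charC k n μ = (2 : k)⁻¹ •
      (charB k n z⁻¹ * charB k n (z * μ) + charB k n (z * μ) * charB k n z⁻¹) := by
    rw [charB_mul_add_mul, smul_smul, inv_mul_cancel₀ two_ne_zero, one_smul,
      inv_mul_cancel_left₀ hz0]
  have hBq : charC k n μ ^ N * (charB k n (z * μ) * charE k n z) ∈ I := by
    rw [charB_mul_charE k hq, ← mul_assoc, ← mul_assoc, ← pow_two]
    exact I.mul_mem_right _ _ hN
  have hBp : charB k n z⁻¹ * charE k n z ∈ I := by
    rw [charB_mul_charE k hp, mul_inv_cancel₀ hz0]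
    exact I.mul_mem_right _ _ h1
  refine ⟨N + 1, ?_⟩
  have hexp : charC k n μ ^ (N + 1) * charE k n z = (2 : k)⁻¹ •
      (charB k n z⁻¹ * (charC k n μ ^ N * (charB k n (z * μ) * charE k n z)) +
        charC k n μ ^ N * charB k n (z * μ) * (charB k n z⁻¹ * charE k n z)) := by
    rw [← mul_assoc (charB k n z⁻¹) (charC k n μ ^ N),
      ← ((commute_charC_charB k n μ z⁻¹).pow_left N).eq, pow_succ]
    nth_rewrite 2 [hC]
    simp only [mul_smul_comm, smul_mul_assoc, mul_add, add_mul, mul_assoc]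
  rw [hexp]
  exact smul_mem_twoSidedIdeal k I _
    (I.add_mem (I.mul_mem_left _ _ hBq) (I.mul_mem_left _ _ hBp))

lemma kills_of_pow_two_pow_mul_pow_eq_one [CharZero k] (hn : n ≠ 0) (hμ : μ ^ n = 1)
    (h1 : charE k n 1 ∈ I) (w : ℕ) (hz : z ^ n = 1) (j : ℕ) (hj : z ^ 2 ^ w * μ ^ j = 1) :
    Kills k n I μ z := by
  induction w generalizing z j with
  | zero =>
    refine Kills.of_mul_pow hμ j ⟨0, ?_⟩
    rw [pow_zero, pow_one] at hj
    simpa [hj] using h1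
  | succ w ih =>
    refine Kills.of_sq_mul hn hμ hz h1 (ih ?_ (j + (n - 1) * 2 ^ w) ?_)
    · rw [mul_pow, pow_right_comm, hz, hμ, one_pow, one_mul]
    · have hexp : 2 ^ w + (n - 1) * 2 ^ w = n * 2 ^ w := by
        obtain ⟨l, rfl⟩ := Nat.exists_eq_succ_of_ne_zero hn
        simp only [Nat.succ_eq_add_one, Nat.add_sub_cancel]
        ring
      have hcancel : μ ^ 2 ^ w * μ ^ ((n - 1) * 2 ^ w) = 1 := by
        rw [← pow_add, hexp, pow_mul, hμ, one_pow]
      calc (z ^ 2 * μ) ^ 2 ^ w * μ ^ (j + (n - 1) * 2 ^ w)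
          = z ^ 2 ^ (w + 1) * μ ^ j * (μ ^ 2 ^ w * μ ^ ((n - 1) * 2 ^ w)) := by
            rw [mul_pow, ← pow_mul, ← pow_succ', pow_add]
            ring
        _ = 1 := by rw [hj, hcancel, one_mul]

lemma exists_dvd_gcd_mul_add_mul (m : ℕ) (hn : n ≠ 0) (a : ℕ) :
    ∃ j : ℕ, n ∣ a * Nat.gcd m n + m * j := by
  have : NeZero n := ⟨hn⟩
  refine ⟨(-(a * (Nat.gcdA m n : ZMod n))).val, ?_⟩
  rw [← ZMod.natCast_eq_zero_iff]
  have h : ((Nat.gcd m n : ℕ) : ZMod n) = m * (Nat.gcdA m n : ZMod n) := by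
    have := congrArg (Int.cast : ℤ → ZMod n) (Nat.gcd_eq_gcd_ab m n)
    simpa using this
  push_cast
  rw [ZMod.natCast_zmod_val, h]
  ring

lemma exists_charC_pow_mem {ω : k} [CharZero k] (hn : n ≠ 0) (hω : IsPrimitiveRoot ω n)
    (h : ∀ z : k, z ^ n = 1 → Kills k n I μ z) : ∃ N : ℕ, charC k n μ ^ N ∈ I := by
  have hk (a : ℕ) : Kills k n I μ (ω ^ a) :=
    h _ (by rw [pow_right_comm, hω.pow_eq_one, one_pow])
  choose N hN using hk
  let M := (Finset.range n).sup N
  have hsum : charC k n μ ^ M * ∑ a ∈ Finset.range n, charE k n (ω ^ a) ∈ I := by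
    rw [Finset.mul_sum]
    refine sum_mem fun a ha => ?_
    have hle : N a ≤ M := Finset.le_sup ha
    rw [← Nat.sub_add_cancel hle, pow_add, mul_assoc]
    exact I.mul_mem_left _ _ (hN a)
  refine ⟨M, ?_⟩
  rw [sum_charE k hω, mul_smul_comm, mul_one] at hsum
  have := smul_mem_twoSidedIdeal k I (n : k)⁻¹ hsum
  rwa [smul_smul, inv_mul_cancel₀ (Nat.cast_ne_zero.2 hn), one_smul] at this

end Characters

end NCIS

open NCIS in
/-- Proposition 2.3(1): if `0 ≤ m ≤ n−1` and `gcd(m, n)` is a power of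
`2` (that is, `m ∈ φ₂(n)`), then some power of `c_m` lies in the two-sided ideal `(e₀)`
of `A#C_n`. -/
theorem c_pow_mem_ideal_e0_of_mem_phi2
    (k : Type*) [Field k] [IsAlgClosed k] [CharZero k]
    (n : ℕ) (hn2 : 2 ≤ n) (ω : k) (hω : IsPrimitiveRoot ω n)
    (m : ℕ) (hm : m ≤ n - 1) (hgcd : ∃ w : ℕ, Nat.gcd m n = 2 ^ w) :
    ∃ N : ℕ, cg k n ω (m : ZMod n) ^ N ∈ TwoSidedIdeal.span {e0 k n} := by
  obtain ⟨w, hw⟩ := hgcd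
  have hn : n ≠ 0 := by omega
  have hμ : (ω ^ m) ^ n = 1 := by rw [pow_right_comm, hω.pow_eq_one, one_pow]
  have h1 : charE k n 1 ∈ TwoSidedIdeal.span {e0 k n} := by
    have he : charE k n 1 = (n : k) • e0 k n := by
      simp [charE, e0, smul_smul, Nat.cast_ne_zero.2 hn]
    rw [he]
    exact smul_mem_twoSidedIdeal k _ _ (TwoSidedIdeal.subset_span rfl)
  have hc : cg k n ω (m : ZMod n) = (2 / (n : k) ^ 2) • charC k n (ω ^ m) := by
    have hval : (m : ZMod n).val = m := ZMod.val_cast_of_lt (by omega)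
    simp only [cg, charC, hval, ← pow_mul, mul_comm m]
  obtain ⟨N, hN⟩ := exists_charC_pow_mem (I := TwoSidedIdeal.span {e0 k n})
      (μ := ω ^ m) hn hω <| by
    intro z hz
    have : NeZero n := ⟨hn⟩
    obtain ⟨a, -, rfl⟩ := hω.eq_pow_of_pow_eq_one hz
    obtain ⟨j, hj⟩ := exists_dvd_gcd_mul_add_mul m hn a
    refine kills_of_pow_two_pow_mul_pow_eq_one hn hμ h1 w hz j ?_
    rwa [← pow_mul, ← pow_mul, ← pow_add, hω.pow_eq_one_iff_dvd, ← hw]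
  refine ⟨N, ?_⟩
  rw [hc, smul_pow]
  exact smul_mem_twoSidedIdeal k _ _ hN
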